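/- Fix an integer d ≥ 1, s ∈ (0,1) and t_0 > 0. There exists a constant C > 0, depending only on d, s and t_0, such that for all t ≥ t_0, all ε ∈ (0,1], and all k, ξ ∈ ℝ^d: (1 − C ε^s) ( |ξ|^{2s} t + |k|^{2s}/(2s) ) ≤ J(ε,t,k,ξ) ≤ (1 + C ε^s) ( |ξ|^{2s} t + |k|^{2s}/(2s) ). -/

import Mathlib

open MeasureTheory

/-- `J(ε,t,k,ξ) = ∫_0^{ε^{−2s} t} |e^{−w}(k − εξ) + εξ|^{2s} dw`, with real powers. -/
noncomputable def Jfun (d : ℕ) (s ε t : ℝ) (k ξ : EuclideanSpace ℝ (Fin d)) : ℝ :=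
  ∫ w in (0 : ℝ)..(ε ^ (-(2 * s)) * t), ‖Real.exp (-w) • (k - ε • ξ) + ε • ξ‖ ^ (2 * s)

/-- Norm powers with exponent at most one are subadditive. -/
lemma norm_add_rpow_le {V : Type*} [SeminormedAddCommGroup V] {s : ℝ} (hs : 0 ≤ s) (hs1 : s ≤ 1)
    (x y : V) : ‖x + y‖ ^ s ≤ ‖x‖ ^ s + ‖y‖ ^ s :=
  (Real.rpow_le_rpow (norm_nonneg _) (norm_add_le x y) hs).trans
    (Real.rpow_add_le_add_rpow (norm_nonneg _) (norm_nonneg _) hs hs1)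

/-- For `0 ≤ s ≤ 1`, the power `‖x + y‖ ^ (2 * s)` splits up to a mixed term. -/
lemma abs_norm_add_rpow_two_mul_sub_le {V : Type*} [SeminormedAddCommGroup V] {s : ℝ}
    (hs : 0 ≤ s) (hs1 : s ≤ 1) (x y : V) :
    |‖x + y‖ ^ (2 * s) - ‖x‖ ^ (2 * s) - ‖y‖ ^ (2 * s)| ≤ 2 * (‖x‖ ^ s * ‖y‖ ^ s) := by
  have sq (z : V) : ‖z‖ ^ (2 * s) = (‖z‖ ^ s) ^ 2 := by
    rw [mul_comm, Real.rpow_mul (norm_nonneg z), Real.rpow_two]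
  have h := norm_add_rpow_le hs hs1 x y
  have hx : ‖x‖ ^ s ≤ ‖x + y‖ ^ s + ‖y‖ ^ s := by
    simpa using norm_add_rpow_le hs hs1 (x + y) (-y)
  have hy : ‖y‖ ^ s ≤ ‖x + y‖ ^ s + ‖x‖ ^ s := by
    simpa using norm_add_rpow_le hs hs1 (x + y) (-x)
  have hn : 0 ≤ ‖x + y‖ ^ s := by positivity
  have lo : (‖x‖ ^ s - ‖y‖ ^ s) ^ 2 ≤ (‖x + y‖ ^ s) ^ 2 :=
    sq_le_sq' (by linarith) (by linarith)
  have up : (‖x + y‖ ^ s) ^ 2 ≤ (‖x‖ ^ s + ‖y‖ ^ s) ^ 2 := by gcongr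
  rw [sq, sq, sq, abs_le]
  constructor <;> nlinarith

lemma integral_exp_neg_mul {c : ℝ} (hc : c ≠ 0) (T : ℝ) :
    ∫ w in (0 : ℝ)..T, Real.exp (-(c * w)) = (1 - Real.exp (-(c * T))) / c := by
  have h (w : ℝ) : HasDerivAt (fun w => -Real.exp (-(c * w)) / c) (Real.exp (-(c * w))) w := by
    refine ((((hasDerivAt_id' w).const_mul c).fun_neg.exp).fun_neg.div_const c).congr_deriv ?_
    field_simp
  rw [intervalIntegral.integral_eq_sub_of_hasDerivAt (fun w _ => h w)
    (Continuous.intervalIntegrable (by fun_prop) _ _)]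
  simp
  ring

/-- Pointwise comparison of the integrand of `Jfun` with its two decoupled limits. -/
lemma norm_exp_smul_sub_add_rpow_bounds {V : Type*} [NormedAddCommGroup V] [NormedSpace ℝ V]
    {s w : ℝ} (hs : 0 ≤ s) (hs1 : s ≤ 1) (hw : 0 ≤ w) (k a : V) :
    ‖k‖ ^ (2 * s) * Real.exp (-(2 * s * w)) + ‖a‖ ^ (2 * s)
        - 2 * ‖a‖ ^ (2 * s) * Real.exp (-(1 * w))
        - 2 * (‖k‖ ^ s * ‖a‖ ^ s) * Real.exp (-(s * w))
      ≤ ‖Real.exp (-w) • (k - a) + a‖ ^ (2 * s) ∧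
    ‖Real.exp (-w) • (k - a) + a‖ ^ (2 * s) ≤
      ‖k‖ ^ (2 * s) * Real.exp (-(2 * s * w)) + ‖a‖ ^ (2 * s)
        + 2 * (‖k‖ ^ s * ‖a‖ ^ s) * Real.exp (-(s * w)) := by
  have hz : Real.exp (-w) ≤ 1 := by simpa using hw
  have hz0 := Real.exp_pos (-w)
  have hexp (c : ℝ) : Real.exp (-w) ^ c = Real.exp (-(c * w)) := by
    rw [← Real.exp_mul]; ring_nf
  have hsplit : Real.exp (-w) • (k - a) + a = Real.exp (-w) • k + (1 - Real.exp (-w)) • a := by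
    module
  have h := abs_norm_add_rpow_two_mul_sub_le hs hs1 (Real.exp (-w) • k) ((1 - Real.exp (-w)) • a)
  rw [← hsplit, norm_smul, norm_smul, Real.norm_of_nonneg hz0.le,
    Real.norm_of_nonneg (sub_nonneg.2 hz)] at h
  simp only [Real.mul_rpow hz0.le (norm_nonneg k),
    Real.mul_rpow (sub_nonneg.2 hz) (norm_nonneg a), hexp] at h
  have h1 : (1 - Real.exp (-w)) ^ s ≤ 1 :=
    Real.rpow_le_one (sub_nonneg.2 hz) (by linarith) hs
  have h2 : (1 - Real.exp (-w)) ^ (2 * s) ≤ 1 :=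
    Real.rpow_le_one (sub_nonneg.2 hz) (by linarith) (by linarith)
  have h3 : 1 - 2 * Real.exp (-w) ≤ (1 - Real.exp (-w)) ^ (2 * s) := by
    have : (1 - Real.exp (-w)) ^ (2 : ℝ) ≤ (1 - Real.exp (-w)) ^ (2 * s) :=
      Real.rpow_le_rpow_of_exponent_ge_of_imp (sub_nonneg.2 hz) (by linarith) (by linarith)
        (by intro _ h; linarith)
    rw [Real.rpow_two] at this
    nlinarith
  have h4 : Real.exp (-(s * w)) * ‖k‖ ^ s * ((1 - Real.exp (-w)) ^ s * ‖a‖ ^ s) ≤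
      Real.exp (-(s * w)) * ‖k‖ ^ s * (1 * ‖a‖ ^ s) := by gcongr
  have h5 := mul_le_mul_of_nonneg_right h2 (by positivity : 0 ≤ ‖a‖ ^ (2 * s))
  have h6 := mul_le_mul_of_nonneg_right h3 (by positivity : 0 ≤ ‖a‖ ^ (2 * s))
  rw [abs_le] at h
  rw [one_mul]
  constructor <;> linarith

/-- The pointwise bounds integrated over `[0, T]`. -/
lemma integral_norm_exp_smul_sub_add_rpow_bounds {V : Type*} [NormedAddCommGroup V]
    [NormedSpace ℝ V] {s T : ℝ} (hs : 0 < s) (hs1 : s ≤ 1) (hT : 0 ≤ T) (k a : V) :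
    ‖k‖ ^ (2 * s) * ((1 - Real.exp (-(2 * s * T))) / (2 * s)) + ‖a‖ ^ (2 * s) * T
        - 2 * ‖a‖ ^ (2 * s) - 2 * (‖k‖ ^ s * ‖a‖ ^ s) / s
      ≤ ∫ w in (0 : ℝ)..T, ‖Real.exp (-w) • (k - a) + a‖ ^ (2 * s) ∧
    ∫ w in (0 : ℝ)..T, ‖Real.exp (-w) • (k - a) + a‖ ^ (2 * s) ≤
      ‖k‖ ^ (2 * s) / (2 * s) + ‖a‖ ^ (2 * s) * T + 2 * (‖k‖ ^ s * ‖a‖ ^ s) / s := by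
  have hint (A c : ℝ) :
      IntervalIntegrable (fun w => A * Real.exp (-(c * w))) volume 0 T :=
    Continuous.intervalIntegrable (by fun_prop) _ _
  have hconst (A : ℝ) : IntervalIntegrable (fun _ : ℝ => A) volume 0 T :=
    intervalIntegrable_const
  have hF : IntervalIntegrable (fun w => ‖Real.exp (-w) • (k - a) + a‖ ^ (2 * s)) volume 0 T :=
    (Continuous.rpow_const (by fun_prop) fun _ => Or.inr (by positivity)).intervalIntegrable _ _
  have hle (c : ℝ) (hc : 0 < c) (B : ℝ) (hB : 0 ≤ B) :
      B * ((1 - Real.exp (-(c * T))) / c) ≤ B / c := by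
    rw [div_eq_mul_one_div B]
    gcongr
    linarith [Real.exp_pos (-(c * T))]
  have h0 : 0 ≤ 2 * (‖k‖ ^ s * ‖a‖ ^ s) := by positivity
  have hlo := intervalIntegral.integral_mono_on hT
    ((((hint (‖k‖ ^ (2 * s)) (2 * s)).add (hconst (‖a‖ ^ (2 * s)))).sub
      (hint (2 * ‖a‖ ^ (2 * s)) 1)).sub (hint (2 * (‖k‖ ^ s * ‖a‖ ^ s)) s)) hF
    fun w hw => (norm_exp_smul_sub_add_rpow_bounds hs.le hs1 hw.1 k a).1
  have hup := intervalIntegral.integral_mono_on hT hF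
    (((hint (‖k‖ ^ (2 * s)) (2 * s)).add (hconst (‖a‖ ^ (2 * s)))).add
      (hint (2 * (‖k‖ ^ s * ‖a‖ ^ s)) s))
    fun w hw => (norm_exp_smul_sub_add_rpow_bounds hs.le hs1 hw.1 k a).2
  rw [intervalIntegral.integral_sub (((hint _ _).add (hconst _)).sub (hint _ _)) (hint _ _),
    intervalIntegral.integral_sub ((hint _ _).add (hconst _)) (hint _ _),
    intervalIntegral.integral_add (hint _ _) (hconst _)] at hlo
  rw [intervalIntegral.integral_add ((hint _ _).add (hconst _)) (hint _ _),
    intervalIntegral.integral_add (hint _ _) (hconst _)] at hup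
  simp only [intervalIntegral.integral_const_mul, intervalIntegral.integral_const,
    integral_exp_neg_mul (by positivity : 2 * s ≠ 0), integral_exp_neg_mul hs.ne',
    integral_exp_neg_mul one_ne_zero, sub_zero, smul_eq_mul] at hlo hup
  have e1 := hle s hs _ h0
  have e2 := hle 1 one_pos (2 * ‖a‖ ^ (2 * s)) (by positivity)
  have e3 := hle (2 * s) (by positivity) (‖k‖ ^ (2 * s)) (by positivity)
  constructor <;> linarith

/-- Fix `d ≥ 1`, `s ∈ (0,1)`, `t₀ > 0`.  There is `C > 0` depending only on `d, s, t₀`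
such that for all `t ≥ t₀`, `ε ∈ (0,1]` and `k, ξ ∈ ℝ^d`:
`(1 − C ε^s)(|ξ|^{2s} t + |k|^{2s}/(2s)) ≤ J(ε,t,k,ξ) ≤ (1 + C ε^s)(|ξ|^{2s} t + |k|^{2s}/(2s))`. -/
theorem stmt_4 (d : ℕ) (hd : 1 ≤ d) (s t₀ : ℝ) (hs : s ∈ Set.Ioo (0 : ℝ) 1) (ht₀ : 0 < t₀) :
    ∃ C : ℝ, 0 < C ∧ ∀ t : ℝ, t₀ ≤ t → ∀ ε ∈ Set.Ioc (0 : ℝ) 1,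
      ∀ k ξ : EuclideanSpace ℝ (Fin d),
        (1 - C * ε ^ s) * (‖ξ‖ ^ (2 * s) * t + ‖k‖ ^ (2 * s) / (2 * s)) ≤ Jfun d s ε t k ξ ∧
        Jfun d s ε t k ξ ≤ (1 + C * ε ^ s) * (‖ξ‖ ^ (2 * s) * t + ‖k‖ ^ (2 * s) / (2 * s)) := by
  obtain ⟨hs0, hs1⟩ := hs
  refine ⟨2 + 1 / (2 * s * t₀) + (1 / s + 2) / t₀, by positivity, ?_⟩
  intro t ht ε ⟨hε, hε1⟩ k ξ
  have ht0 : 0 < t := ht₀.trans_le ht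
  have hT : 0 < ε ^ (-(2 * s)) * t := by positivity
  obtain ⟨hlo, hup⟩ :=
    integral_norm_exp_smul_sub_add_rpow_bounds hs0 hs1.le hT.le k (ε • ξ)
  change _ ≤ Jfun d s ε t k ξ at hlo
  change Jfun d s ε t k ξ ≤ _ at hup
  have sq {r : ℝ} (hr : 0 ≤ r) : r ^ (2 * s) = (r ^ s) ^ 2 := by
    rw [mul_comm, Real.rpow_mul hr, Real.rpow_two]
  have htail : Real.exp (-(2 * s * (ε ^ (-(2 * s)) * t))) ≤ ε ^ s / (2 * s * t₀) := by
    have hpos : 0 < 2 * s * (ε ^ (-(2 * s)) * t) := by positivity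
    calc Real.exp (-(2 * s * (ε ^ (-(2 * s)) * t)))
        ≤ (2 * s * (ε ^ (-(2 * s)) * t))⁻¹ := by
          rw [Real.exp_neg]
          exact inv_anti₀ hpos (by linarith [Real.add_one_le_exp (2 * s * (ε ^ (-(2 * s)) * t))])
      _ = ε ^ (2 * s) / (2 * s * t) := by
          rw [Real.rpow_neg hε.le]; field_simp
      _ ≤ ε ^ s / (2 * s * t₀) := by
          have : ε ^ (2 * s) ≤ ε ^ s :=
            Real.rpow_le_rpow_of_exponent_ge hε hε1 (by linarith)
          gcongr
  have he0 : 0 < ε ^ s := by positivity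
  have he1 : ε ^ s ≤ 1 := Real.rpow_le_one hε.le hε1 hs0.le
  rw [norm_smul, Real.norm_of_nonneg hε.le, Real.mul_rpow hε.le (norm_nonneg ξ),
    Real.mul_rpow hε.le (norm_nonneg ξ)] at hlo hup
  have hAT : ε ^ (2 * s) * ‖ξ‖ ^ (2 * s) * (ε ^ (-(2 * s)) * t) = ‖ξ‖ ^ (2 * s) * t := by
    rw [Real.rpow_neg hε.le]; field_simp
  rw [hAT] at hlo hup
  rw [sq (norm_nonneg k), sq (norm_nonneg ξ)] at hlo hup ⊢
  rw [sq hε.le] at hlo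
  generalize Real.exp (-(2 * s * (ε ^ (-(2 * s)) * t))) = q at hlo htail
  generalize ‖k‖ ^ s = x at *
  generalize ‖ξ‖ ^ s = y at *
  generalize ε ^ s = e at *
  have hmix : 2 * (x * (e * y)) / s ≤ e * ((x ^ 2 + y ^ 2) / s) := by
    rw [← mul_div_assoc]
    refine div_le_div_of_nonneg_right ?_ hs0.le
    nlinarith [mul_nonneg he0.le (sq_nonneg (x - y))]
  have hsq : 2 * (e ^ 2 * y ^ 2) ≤ e * (2 * y ^ 2) := by
    nlinarith [mul_nonneg (mul_nonneg he0.le (sub_nonneg.2 he1)) (sq_nonneg y)]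
  have hq : x ^ 2 * (1 / (2 * s)) - e * (x ^ 2 / (2 * s * t₀) / (2 * s)) ≤
      x ^ 2 * ((1 - q) / (2 * s)) := by
    have : x ^ 2 * (q / (2 * s)) ≤ x ^ 2 * (e / (2 * s * t₀) / (2 * s)) := by gcongr
    have e1 : x ^ 2 * (e / (2 * s * t₀) / (2 * s)) = e * (x ^ 2 / (2 * s * t₀) / (2 * s)) := by
      ring
    rw [sub_div, mul_sub]
    linarith
  have hC : (x ^ 2 + y ^ 2) / s + 2 * y ^ 2 + x ^ 2 / (2 * s * t₀) / (2 * s) ≤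
      (2 + 1 / (2 * s * t₀) + (1 / s + 2) / t₀) * (y ^ 2 * t + x ^ 2 / (2 * s)) := by
    calc _ = (2 + 1 / (2 * s * t₀)) * (x ^ 2 / (2 * s)) +
          (1 / s + 2) / t₀ * (y ^ 2 * t₀) := by field_simp; ring
      _ ≤ (2 + 1 / (2 * s * t₀) + (1 / s + 2) / t₀) * (x ^ 2 / (2 * s)) +
          (2 + 1 / (2 * s * t₀) + (1 / s + 2) / t₀) * (y ^ 2 * t) := by
          have h1 : 0 ≤ (1 / s + 2) / t₀ := by positivity
          have h2 : 0 ≤ 1 / (2 * s * t₀) := by positivity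
          exact add_le_add (mul_le_mul_of_nonneg_right (by linarith) (by positivity))
            (mul_le_mul (by linarith) (by gcongr) (by positivity) (by positivity))
      _ = _ := by ring
  have hCe := mul_le_mul_of_nonneg_left hC he0.le
  have hp1 : 0 ≤ e * (2 * y ^ 2) := by positivity
  have hp2 : 0 ≤ e * (x ^ 2 / (2 * s * t₀) / (2 * s)) := by positivity
  rw [mul_one_div] at hq
  constructor <;> linarith
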